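/- Let X be a Polish metric space which is approximately ultrahomogeneous, and let G = Iso(X) be its group of bijective self-isometries endowed with the topology of pointwise convergence. Then G is extremely amenable if and only if X has the weak approximate Ramsey property: for every finite subset A of X, every finite subset B of X containing A, all isometric embeddings α₁, …, α_m ∈ Emb(A,B), and every ε > 0, there exist a finite subset B' of X containing A, isometric embeddings α'₁, …, α'_m ∈ Emb(A,B') with max_{a∈A} d(α_i(a), α'_i(a)) ≤ ε for each i, and a finite subset C of X, such that for every coloring γ of Emb(A,C) there exists β ∈ Emb(B',C) such that the oscillation of γ on {β∘α'₁, …, β∘α'_m} is less than ε. -/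

import Mathlib

open Set

universe u

/-- A topological group `G` is extremely amenable if every continuous action of `G` on a
nonempty compact Hausdorff space has a fixed point. -/
def ExtremelyAmenable (G : Type*) [Group G] [TopologicalSpace G] : Prop :=
  ∀ (Y : Type u) [TopologicalSpace Y] [CompactSpace Y] [T2Space Y] [Nonempty Y]
    [MulAction G Y] [ContinuousSMul G Y], ∃ y : Y, ∀ g : G, g • y = y

/-- The topology of pointwise convergence on the isometry group of a metric space. -/
def isoPointwiseTopology (X : Type*) [MetricSpace X] : TopologicalSpace (X ≃ᵢ X) :=
  TopologicalSpace.induced (fun f : X ≃ᵢ X => (f : X → X)) Pi.topologicalSpace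

/-- The sup-distance `ρ(α, β) = sup_{a ∈ A} d(α a, β a)` between two maps defined on `A`. -/
noncomputable def embDist {A Y : Type*} [MetricSpace Y] (α β : A → Y) : ℝ :=
  ⨆ a : A, dist (α a) (β a)

/-- A coloring of a family `S` of maps: a `[0,1]`-valued map which is `1`-Lipschitz for the
sup-distance on `S`. -/
def IsColoringOn {A Y : Type*} [MetricSpace Y] (S : Set (A → Y)) (γ : (A → Y) → ℝ) : Prop :=
  (∀ α ∈ S, γ α ∈ Set.Icc (0 : ℝ) 1) ∧
    ∀ α ∈ S, ∀ β ∈ S, |γ α - γ β| ≤ embDist α β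

/-- A metric space `X` is approximately ultrahomogeneous if every isometric embedding of a
finite subset of `X` into `X` is `ε`-approximated by a bijective self-isometry of `X`. -/
def ApproxUltrahomogeneous (X : Type*) [MetricSpace X] : Prop :=
  ∀ A : Set X, A.Finite → ∀ φ : A → X, Isometry φ → ∀ ε : ℝ, 0 < ε →
    ∃ ψ : X ≃ᵢ X, ∀ a : A, dist (φ a) (ψ a) < ε

universe v w

namespace ExtremelyAmenable

/-- An extremely amenable group has fixed points in all compact spaces which are small relative to
the universe of the definition. -/
theorem exists_fixedPoint_of_small {G : Type*} [Group G] [TopologicalSpace G]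
    (hG : ExtremelyAmenable.{w} G) (K : Type v) [Small.{w} K] [TopologicalSpace K]
    [CompactSpace K] [T2Space K] [Nonempty K] [MulAction G K] [ContinuousSMul G K] :
    ∃ y : K, ∀ g : G, g • y = y := by
  let e : K ≃ₜ Shrink.{w} K := Shrink.homeomorph K
  have hsmul : ∀ (g : G) (y : Shrink.{w} K), g • y = e (g • e.symm y) := fun _ _ => rfl
  have : CompactSpace (Shrink.{w} K) := e.compactSpace
  have : T2Space (Shrink.{w} K) := e.t2Space
  have : Nonempty (Shrink.{w} K) := e.symm.toEquiv.nonempty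
  have : ContinuousSMul G (Shrink.{w} K) :=
    ⟨by
      simp only [hsmul]
      fun_prop⟩
  obtain ⟨y, hy⟩ := hG (Shrink.{w} K)
  refine ⟨e.symm y, fun g => e.injective ?_⟩
  rw [← hsmul, hy, e.apply_symm_apply]

end ExtremelyAmenable

section PointwiseTopology

open Topology Filter

variable {X : Type*} [MetricSpace X]

attribute [local instance] isoPointwiseTopology

theorem continuous_isoPointwise_apply (x : X) : Continuous fun g : X ≃ᵢ X => g x :=
  (continuous_apply x).comp continuous_induced_dom

theorem continuous_isoPointwise_inv_apply (x : X) : Continuous fun g : X ≃ᵢ X => g⁻¹ x := by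
  refine continuous_iff_continuousAt.2 fun g => tendsto_iff_dist_tendsto_zero.2 ?_
  have h := tendsto_iff_dist_tendsto_zero.1
    ((continuous_isoPointwise_apply (g⁻¹ x)).tendsto g)
  refine h.congr fun k => ?_
  rw [← k.isometry.dist_eq (k⁻¹ x), IsometryEquiv.apply_inv_self, IsometryEquiv.apply_inv_self,
    dist_comm]

theorem exists_finite_of_mem_nhds_one {U : Set (X ≃ᵢ X)} (hU : U ∈ 𝓝 (1 : X ≃ᵢ X)) :
    ∃ A : Set X, A.Finite ∧ ∃ δ : ℝ, 0 < δ ∧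
      ∀ g : X ≃ᵢ X, (∀ a ∈ A, dist (g a) a < δ) → g ∈ U := by
  have hnhds : 𝓝 (1 : X ≃ᵢ X) = comap (fun f : X ≃ᵢ X => (f : X → X)) (𝓝 ⇑(1 : X ≃ᵢ X)) :=
    nhds_induced _ _
  rw [hnhds, nhds_pi, mem_comap] at hU
  obtain ⟨V, hV, hVU⟩ := hU
  obtain ⟨⟨A, r⟩, ⟨hA, hr⟩, hsub⟩ :=
    (hasBasis_pi fun x : X => Metric.nhds_basis_ball (x := (1 : X ≃ᵢ X) x)).mem_iff.1 hV
  obtain ⟨δ, hδ, hδr⟩ : ∃ δ : ℝ, 0 < δ ∧ ∀ a ∈ A, δ ≤ r a := by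
    have : ∀ᶠ δ in 𝓝[>] (0 : ℝ), ∀ a ∈ A, δ ≤ r a :=
      (eventually_all_finite hA).2 fun a ha =>
        eventually_nhdsWithin_of_eventually_nhds (eventually_le_nhds (hr a ha))
    obtain ⟨δ, h1, h2⟩ := (this.and self_mem_nhdsWithin).exists
    exact ⟨δ, h2, h1⟩
  exact ⟨A, hA, δ, hδ, fun g hg => hVU (hsub fun a ha => (hg a ha).trans_le (hδr a ha))⟩

/-- Evaluating a continuous function along a continuous action on a compact space is uniformly
continuous: the displacement is controlled by finitely many points of `X`. -/
theorem exists_finite_forall_smul_lt {Y : Type*} [TopologicalSpace Y] [CompactSpace Y]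
    [MulAction (X ≃ᵢ X) Y] [ContinuousSMul (X ≃ᵢ X) Y] {f : Y → ℝ} (hf : Continuous f)
    {ε : ℝ} (hε : 0 < ε) :
    ∃ A : Set X, A.Finite ∧ ∃ δ : ℝ, 0 < δ ∧
      ∀ g : X ≃ᵢ X, (∀ a ∈ A, dist (g a) a < δ) → ∀ y : Y, |f (g • y) - f y| < ε := by
  refine exists_finite_of_mem_nhds_one (U := {g | ∀ y : Y, |f (g • y) - f y| < ε}) ?_
  have := isCompact_univ.eventually_forall_of_forall_eventually (x₀ := (1 : X ≃ᵢ X))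
    (K := (univ : Set Y)) (P := fun g y => |f (g • y) - f y| < ε) fun y _ => by
      have hc : Continuous fun z : (X ≃ᵢ X) × Y => |f (z.1 • z.2) - f z.2| := by fun_prop
      exact hc.continuousAt.eventually_lt continuousAt_const (by simpa using hε)
  exact this.mono fun g hg y => hg y (mem_univ y)

end PointwiseTopology

section EmbDist

variable {A Y : Type*} [MetricSpace Y]

theorem dist_le_embDist [Finite A] (α β : A → Y) (a : A) : dist (α a) (β a) ≤ embDist α β :=
  le_ciSup (f := fun a => dist (α a) (β a)) (Set.finite_range _).bddAbove a

theorem embDist_nonneg (α β : A → Y) : 0 ≤ embDist α β :=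
  Real.iSup_nonneg fun _ => dist_nonneg

theorem embDist_le {α β : A → Y} {r : ℝ} (hr : 0 ≤ r) (h : ∀ a, dist (α a) (β a) ≤ r) :
    embDist α β ≤ r :=
  Real.iSup_le h hr

theorem embDist_triangle [Finite A] (α β γ : A → Y) :
    embDist α γ ≤ embDist α β + embDist β γ :=
  embDist_le (add_nonneg (embDist_nonneg _ _) (embDist_nonneg _ _)) fun a =>
    (dist_triangle _ (β a) _).trans (add_le_add (dist_le_embDist _ _ a) (dist_le_embDist _ _ a))

theorem embDist_comm (α β : A → Y) : embDist α β = embDist β α := by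
  simp only [embDist, dist_comm]

end EmbDist

/-- The isometric embeddings of `A` into `X`. -/
def IsoEmb (A X : Type*) [MetricSpace A] [MetricSpace X] : Type _ :=
  {δ : A → X // Isometry δ}

namespace IsoEmb

variable {A X : Type*} [MetricSpace A] [MetricSpace X]

instance : MulAction (X ≃ᵢ X) (IsoEmb A X) where
  smul g δ := ⟨g ∘ δ.1, g.isometry.comp δ.2⟩
  one_smul _ := rfl
  mul_smul _ _ _ := rfl

instance small [TopologicalSpace.SeparableSpace X] [Finite A] : Small.{w} (IsoEmb A X) := by
  have : Small.{w} X := small_of_injective (kuratowskiEmbedding.isometry X).injective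
  have : Small.{w} A := Countable.toSmall A
  exact small_subtype (A → X) _

end IsoEmb

section FixedColoring

open Topology Filter

variable {X : Type*} [MetricSpace X]

attribute [local instance] isoPointwiseTopology

/-- If the isometry group of `X` is extremely amenable, then the closure of the orbit of a coloring
of the embeddings of `A` into `X` contains an invariant coloring. -/
theorem ExtremelyAmenable.exists_invariant_coloring [TopologicalSpace.SeparableSpace X]
    (hG : ExtremelyAmenable.{w} (X ≃ᵢ X)) {A : Type*} [MetricSpace A] [Finite A]
    {γ : IsoEmb A X → ℝ} (hγ : ∀ δ, γ δ ∈ Icc (0 : ℝ) 1)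
    (hγL : ∀ δ δ', |γ δ - γ δ'| ≤ embDist δ.1 δ'.1) :
    ∃ γ₀ ∈ closure (range fun (g : X ≃ᵢ X) (δ : IsoEmb A X) => γ (g⁻¹ • δ)),
      (∀ δ δ', |γ₀ δ - γ₀ δ'| ≤ embDist δ.1 δ'.1) ∧
        ∀ (g : X ≃ᵢ X) (δ : IsoEmb A X), γ₀ (g • δ) = γ₀ δ := by
  cases nonempty_fintype A
  set Z := closure (range fun (g : X ≃ᵢ X) (δ : IsoEmb A X) => γ (g⁻¹ • δ)) with hZ
  have hZ01 : Z ⊆ pi univ fun _ => Icc (0 : ℝ) 1 := by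
    refine closure_minimal ?_ (isClosed_set_pi fun _ _ => isClosed_Icc)
    rintro _ ⟨g, rfl⟩ δ -
    exact hγ _
  have hZL : Z ⊆ {φ | ∀ δ δ', |φ δ - φ δ'| ≤ embDist δ.1 δ'.1} := by
    refine closure_minimal ?_ ?_
    · rintro _ ⟨g, rfl⟩ δ δ'
      refine (hγL _ _).trans (embDist_le (embDist_nonneg _ _) fun a => ?_)
      exact ((g⁻¹).isometry.dist_eq _ _).trans_le (dist_le_embDist _ _ a)
    · simp only [ofPred_forall]
      exact isClosed_iInter fun δ => isClosed_iInter fun δ' =>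
        isClosed_le (by fun_prop) continuous_const
  have hZinv : ∀ (g : X ≃ᵢ X), ∀ φ ∈ Z, (fun δ => φ (g⁻¹ • δ)) ∈ Z := by
    intro g φ hφ
    refine map_mem_closure (f := fun (φ : IsoEmb A X → ℝ) δ => φ (g⁻¹ • δ)) (by fun_prop) hφ ?_
    rintro _ ⟨k, rfl⟩
    exact ⟨g * k, by simp only [mul_inv_rev, mul_smul]⟩
  have hZc : IsCompact Z :=
    (isCompact_univ_pi fun _ => isCompact_Icc).of_isClosed_subset isClosed_closure hZ01
  have : CompactSpace Z := isCompact_iff_compactSpace.1 hZc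
  have : Nonempty Z := ⟨⟨_, subset_closure (mem_range_self 1)⟩⟩
  let : MulAction (X ≃ᵢ X) Z :=
    { smul := fun g φ => ⟨fun δ => φ.1 (g⁻¹ • δ), hZinv g φ.1 φ.2⟩
      one_smul := fun _ => rfl
      mul_smul := fun _ _ _ => rfl }
  have : ContinuousSMul (X ≃ᵢ X) Z := by
    refine ⟨continuous_induced_rng.2 (continuous_pi fun δ => continuous_iff_continuousAt.2 ?_)⟩
    rintro ⟨g, φ⟩
    refine tendsto_iff_dist_tendsto_zero.2 ?_
    have hc : Continuous fun p : (X ≃ᵢ X) × Z =>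
        ∑ a, dist (p.1⁻¹ (δ.1 a)) (g⁻¹ (δ.1 a)) + |p.2.1 (g⁻¹ • δ) - φ.1 (g⁻¹ • δ)| := by
      have h1 : ∀ a, Continuous fun p : (X ≃ᵢ X) × Z => p.1⁻¹ (δ.1 a) := fun a =>
        (continuous_isoPointwise_inv_apply (δ.1 a)).comp continuous_fst
      have h2 : Continuous fun p : (X ≃ᵢ X) × Z => p.2.1 (g⁻¹ • δ) :=
        (continuous_apply _).comp (continuous_subtype_val.comp continuous_snd)
      fun_prop
    have hlim := hc.tendsto (g, φ)
    simp only [dist_self, Finset.sum_const_zero, sub_self, abs_zero, add_zero] at hlim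
    refine squeeze_zero (fun _ => dist_nonneg) (fun p => ?_) hlim
    have hL := hZL p.2.2 (p.1⁻¹ • δ) (g⁻¹ • δ)
    have hs : embDist (p.1⁻¹ • δ).1 (g⁻¹ • δ).1 ≤ ∑ a, dist (p.1⁻¹ (δ.1 a)) (g⁻¹ (δ.1 a)) :=
      embDist_le (Finset.sum_nonneg fun _ _ => dist_nonneg) fun a =>
        Finset.single_le_sum (f := fun a => dist (p.1⁻¹ (δ.1 a)) (g⁻¹ (δ.1 a)))
          (fun _ _ => dist_nonneg) (Finset.mem_univ a)
    exact (abs_sub_le _ (p.2.1 (g⁻¹ • δ)) _).trans (add_le_add (hL.trans hs) le_rfl)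
  obtain ⟨γ₀, hγ₀⟩ := hG.exists_fixedPoint_of_small Z
  refine ⟨γ₀.1, γ₀.2, hZL γ₀.2, fun g δ => ?_⟩
  have := congrFun (congrArg Subtype.val (hγ₀ g⁻¹)) δ
  rw [← this]
  exact congrArg (fun k : X ≃ᵢ X => γ₀.1 (k • δ)) (inv_inv g).symm

end FixedColoring

theorem ApproxUltrahomogeneous.eq_of_invariant {X : Type*} [MetricSpace X]
    (hX : ApproxUltrahomogeneous X) {A : Set X} (hA : A.Finite) {γ : IsoEmb A X → ℝ}
    (hγL : ∀ δ δ', |γ δ - γ δ'| ≤ embDist δ.1 δ'.1)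
    (hγ : ∀ (g : X ≃ᵢ X) (δ : IsoEmb A X), γ (g • δ) = γ δ) (δ δ' : IsoEmb A X) :
    γ δ = γ δ' := by
  suffices h : ∀ δ : IsoEmb A X, γ δ = γ ⟨Subtype.val, isometry_subtype_coe⟩ from
    (h δ).trans (h δ').symm
  intro δ
  refine eq_of_abs_sub_le_all fun ε hε => ?_
  obtain ⟨ψ, hψ⟩ := hX A hA δ.1 δ.2 ε hε
  rw [← hγ ψ ⟨Subtype.val, isometry_subtype_coe⟩]
  exact (hγL _ _).trans (embDist_le hε.le fun a => (hψ a).le)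

section Ramsey

open Topology Filter

variable {X : Type*} [MetricSpace X]

attribute [local instance] isoPointwiseTopology

open Classical in
/-- If the isometry group of an approximately ultrahomogeneous space `X` is extremely amenable,
then `X` satisfies the approximate Ramsey property. -/
theorem ExtremelyAmenable.exists_finite_ramsey [TopologicalSpace.SeparableSpace X]
    (hG : ExtremelyAmenable.{w} (X ≃ᵢ X)) (hX : ApproxUltrahomogeneous X) {A B : Set X}
    (hA : A.Finite) (hB : B.Finite) {ι : Type*} [Finite ι] (α : ι → A → B)
    (hα : ∀ i, Isometry (α i)) {ε : ℝ} (hε : 0 < ε) :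
    ∃ C : Set X, C.Finite ∧
      ∀ γ : (A → C) → ℝ, IsColoringOn {δ : A → C | Isometry δ} γ →
        ∃ β : B → C, Isometry β ∧ ∀ i j, |γ (β ∘ α i) - γ (β ∘ α j)| < ε := by
  by_contra! hbad
  have : Finite A := hA
  choose! c hc hbad using fun C : Finset X => hbad C C.finite_toSet
  let val : Finset X → IsoEmb A X → ℝ := fun C δ =>
    if h : ∀ a, δ.1 a ∈ (C : Set X) then c C fun a => ⟨δ.1 a, h a⟩ else 0
  have hval : ∀ (C : Finset X) δ (h : ∀ a, δ.1 a ∈ (C : Set X)),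
      val C δ = c C fun a => ⟨δ.1 a, h a⟩ :=
    fun C δ h => dif_pos h
  have hval01 : ∀ C, val C ∈ pi univ fun _ : IsoEmb A X => Icc (0 : ℝ) 1 := by
    rintro C δ -
    by_cases h : ∀ a, δ.1 a ∈ (C : Set X)
    · rw [hval C δ h]
      exact (hc C).1 _ δ.2
    · rw [show val C δ = 0 from dif_neg h]
      exact left_mem_Icc.2 zero_le_one
  have hmem : ∀ δ : IsoEmb A X, ∀ᶠ C : Finset X in atTop, ∀ a, δ.1 a ∈ (C : Set X) := fun δ =>
    eventually_all.2 fun a => (eventually_ge_atTop {δ.1 a}).mono fun C hC => hC (by simp)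
  obtain ⟨U, hU⟩ : ∃ U : Ultrafilter (Finset X), (U : Filter (Finset X)) ≤ atTop :=
    ⟨Ultrafilter.of atTop, Ultrafilter.of_le _⟩
  obtain ⟨γ, hγ01, hγ⟩ := (isCompact_univ_pi fun _ : IsoEmb A X =>
    isCompact_Icc (a := (0 : ℝ)) (b := 1)).ultrafilter_le_nhds
      (U.map val) (by
        rw [Ultrafilter.coe_map, le_principal_iff, mem_map]
        exact univ_mem' hval01)
  have hlim : ∀ δ, Tendsto (fun C => val C δ) U (𝓝 (γ δ)) := fun δ =>
    (continuous_apply δ).continuousAt.tendsto.comp hγ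
  have hγL : ∀ δ δ', |γ δ - γ δ'| ≤ embDist δ.1 δ'.1 := by
    intro δ δ'
    refine le_of_tendsto ((hlim δ).sub (hlim δ')).abs ?_
    filter_upwards [hU (hmem δ), hU (hmem δ')] with C h h'
    rw [hval C δ h, hval C δ' h']
    exact (hc C).2 _ δ.2 _ δ'.2
  obtain ⟨γ₀, hγ₀, hγ₀L, hγ₀inv⟩ :=
    hG.exists_invariant_coloring (fun δ => hγ01 δ (mem_univ δ)) hγL
  let α' : ι → IsoEmb A X := fun i => ⟨fun a => α i a, isometry_subtype_coe.comp (hα i)⟩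
  have hopen : ∀ᶠ φ in 𝓝 γ₀, ∀ i j, |φ (α' i) - φ (α' j)| < ε := by
    refine eventually_all.2 fun i => eventually_all.2 fun j => ?_
    have hcont : Continuous fun φ : IsoEmb A X → ℝ => |φ (α' i) - φ (α' j)| := by fun_prop
    refine hcont.continuousAt.eventually_lt continuousAt_const ?_
    rw [hX.eq_of_invariant hA hγ₀L hγ₀inv (α' i) (α' j), sub_self, abs_zero]
    exact hε
  obtain ⟨_, hφ, g, rfl⟩ := mem_closure_iff_nhds.1 hγ₀ _ hopen
  have hsmall : ∀ᶠ C in U,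
      ∀ i j, |val C (g⁻¹ • α' i) - val C (g⁻¹ • α' j)| < ε :=
    eventually_all.2 fun i => eventually_all.2 fun j =>
      ((hlim _).sub (hlim _)).abs.eventually_lt_const (hφ i j)
  have hBC : ∀ᶠ C : Finset X in U, ∀ b ∈ B, g⁻¹ b ∈ (C : Set X) :=
    hU ((eventually_all_finite hB).2 fun b _ =>
      (eventually_ge_atTop {g⁻¹ b}).mono fun C hC => hC (by simp))
  obtain ⟨C, hC, hCB⟩ := (hsmall.and hBC).exists
  obtain ⟨i, j, hij⟩ := hbad C (fun b => ⟨g⁻¹ b, hCB b b.2⟩)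
    (Isometry.of_dist_eq fun b b' => (g⁻¹).isometry.dist_eq _ _)
  refine (hC i j).not_ge ?_
  rwa [hval C _ fun a => hCB _ (α i a).2, hval C _ fun a => hCB _ (α j a).2]

end Ramsey

/-- The weak approximate Ramsey property of a metric space. -/
def WeakApproximateRamsey (X : Type*) [MetricSpace X] : Prop :=
  ∀ A B : Set X, A.Finite → B.Finite → A ⊆ B →
    ∀ m : ℕ, ∀ α : Fin m → (↥A → ↥B), (∀ i, Isometry (α i)) →
    ∀ ε : ℝ, 0 < ε →
    ∃ B' : Set X, B'.Finite ∧ A ⊆ B' ∧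
      ∃ α' : Fin m → (↥A → ↥B'), (∀ i, Isometry (α' i)) ∧
        (∀ i, ∀ a : ↥A, dist (α i a : X) (α' i a : X) ≤ ε) ∧
        ∃ C : Set X, C.Finite ∧
          ∀ γ : (↥A → ↥C) → ℝ, IsColoringOn {δ : ↥A → ↥C | Isometry δ} γ →
            ∃ β : ↥B' → ↥C, Isometry β ∧
              ∀ i j : Fin m, |γ (β ∘ α' i) - γ (β ∘ α' j)| < ε

/-- A bounded function of a family of maps which varies little at scale `δ` is, after scaling by
`δ`, uniformly close to a coloring. -/
theorem exists_coloring_near {A Y ι : Type*} [MetricSpace Y] [Finite A] [Nonempty ι]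
    (p : ι → A → Y) {F : ι → ℝ} (hF : ∀ i, F i ∈ Icc (0 : ℝ) 1) {δ η : ℝ} (hδ : 0 < δ)
    (hδ1 : δ ≤ 1) (hη : 0 ≤ η) (hpF : ∀ i j, embDist (p i) (p j) < δ → |F i - F j| ≤ η) :
    ∃ Φ : (A → Y) → ℝ, (∀ x, Φ x ∈ Icc (0 : ℝ) 1) ∧ (∀ x y, |Φ x - Φ y| ≤ embDist x y) ∧
      ∀ i, |Φ (p i) - δ * F i| ≤ δ * η := by
  have hnn : ∀ x i, 0 ≤ min 1 (δ * F i + embDist (p i) x) := fun x i =>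
    le_min zero_le_one (add_nonneg (mul_nonneg hδ.le (hF i).1) (embDist_nonneg _ _))
  have hbdd : ∀ x, BddBelow (range fun i => min 1 (δ * F i + embDist (p i) x)) := fun x =>
    ⟨0, by rintro _ ⟨i, rfl⟩; exact hnn x i⟩
  have hδF : ∀ i, δ * F i ≤ δ := fun i => mul_le_of_le_one_right hδ.le (hF i).2
  have hlip : ∀ x y, (⨅ i, min 1 (δ * F i + embDist (p i) x)) ≤
      (⨅ i, min 1 (δ * F i + embDist (p i) y)) + embDist x y := by
    intro x y
    rw [← sub_le_iff_le_add]
    refine le_ciInf fun i => ?_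
    have h1 := ciInf_le (hbdd x) i
    have h2 := embDist_triangle (p i) y x
    have h3 := embDist_nonneg x y
    rw [embDist_comm y x] at h2
    rw [sub_le_iff_le_add, min_add]
    exact h1.trans (min_le_min (by linarith) (by linarith))
  refine ⟨fun x => ⨅ i, min 1 (δ * F i + embDist (p i) x), fun x => ⟨le_ciInf (hnn x), ?_⟩,
    fun x y => ?_, fun i => ?_⟩
  · exact (ciInf_le (hbdd x) (Classical.arbitrary ι)).trans (min_le_left _ _)
  · have h := hlip y x
    rw [embDist_comm y x] at h
    exact abs_sub_le_iff.2 ⟨by linarith [hlip x y], by linarith⟩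
  · have hself : embDist (p i) (p i) = 0 :=
      le_antisymm (embDist_le le_rfl fun a => (dist_self _).le) (embDist_nonneg _ _)
    have hup : (⨅ j, min 1 (δ * F j + embDist (p j) (p i))) ≤ δ * F i :=
      (ciInf_le (hbdd (p i)) i).trans ((min_le_right _ _).trans (by rw [hself, add_zero]))
    have hlow : δ * F i - δ * η ≤ ⨅ j, min 1 (δ * F j + embDist (p j) (p i)) := by
      have hδη := mul_nonneg hδ.le hη
      refine le_ciInf fun j => le_min (by linarith [hδF i]) ?_
      rcases lt_or_ge (embDist (p j) (p i)) δ with h | h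
      · have := mul_le_mul_of_nonneg_left (abs_le.1 (hpF j i h)).1 hδ.le
        have := embDist_nonneg (p j) (p i)
        linarith
      · linarith [hδF i, mul_nonneg hδ.le (hF j).1]
    exact abs_le.2 ⟨by linarith, by linarith [mul_nonneg hδ.le hη]⟩

namespace WeakApproximateRamsey

open Topology Filter

variable {X : Type*} [MetricSpace X]

attribute [local instance] isoPointwiseTopology

variable {Y : Type*} [TopologicalSpace Y] [CompactSpace Y] [MulAction (X ≃ᵢ X) Y]
  [ContinuousSMul (X ≃ᵢ X) Y]

theorem exists_forall_abs_smul_sub_le (hR : WeakApproximateRamsey X)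
    (hX : ApproxUltrahomogeneous X) {f : Y → ℝ} (hf : Continuous f)
    (hf01 : ∀ y, f y ∈ Icc (0 : ℝ) 1) (y₀ : Y) (S : Finset (X ≃ᵢ X)) {ε : ℝ} (hε : 0 < ε) :
    ∃ h : X ≃ᵢ X, ∀ g ∈ S, ∀ g' ∈ S, |f (g • h • y₀) - f (g' • h • y₀)| ≤ ε := by
  obtain ⟨A, hA, δ₀, hδ₀, hδ₀f⟩ :=
    exists_finite_forall_smul_lt (X := X) hf (show 0 < ε / 7 by positivity)
  have : Finite A := hA
  obtain ⟨δ, hδ, hδ1, hδδ₀⟩ : ∃ δ : ℝ, 0 < δ ∧ δ ≤ 1 ∧ δ ≤ δ₀ :=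
    ⟨min 1 δ₀, lt_min one_pos hδ₀, min_le_left _ _, min_le_right _ _⟩
  obtain ⟨Φ, hΦ01, hΦL, hΦ⟩ := exists_coloring_near (fun (g : X ≃ᵢ X) (a : A) => g a)
    (F := fun g => f (g⁻¹ • y₀)) (fun g => hf01 _) hδ hδ1 (show 0 ≤ ε / 7 by positivity) (by
      intro g g' hgg'
      have h := hδ₀f (g⁻¹ * g') (fun a ha => ?_) (g'⁻¹ • y₀)
      · rw [mul_smul, smul_inv_smul] at h
        exact h.le
      · have h1 := dist_le_embDist (fun a : A => g a) (fun a : A => g' a) ⟨a, ha⟩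
        rw [← g.isometry.dist_eq, IsometryEquiv.mul_apply, IsometryEquiv.apply_inv_self, dist_comm]
        exact h1.trans_lt (hgg'.trans_le hδδ₀))
  obtain ⟨ε₁, hε₁_def⟩ : ∃ ε₁, ε₁ = δ * (ε / 7) := ⟨_, rfl⟩
  have hε₁ : 0 < ε₁ := by rw [hε₁_def]; positivity
  have h7 : 7 * ε₁ = δ * ε := by rw [hε₁_def]; ring
  rw [← hε₁_def] at hΦ
  clear hε₁_def
  let e := S.equivFin.symm
  obtain ⟨B', hB', -, α', -, hαα', C, -, hC⟩ := hR A (A ∪ ⋃ g ∈ S, ⇑g⁻¹ '' A) hA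
    (hA.union (S.finite_toSet.biUnion fun g _ => hA.image _)) subset_union_left S.card
    (fun i a => ⟨(e i).1⁻¹ a, Or.inr (mem_biUnion (e i).2 (mem_image_of_mem _ a.2))⟩)
    (fun i => Isometry.of_dist_eq fun a b => ((e i).1⁻¹).isometry.dist_eq _ _) ε₁ hε₁
  obtain ⟨β, hβ, hβosc⟩ := hC (fun x => Φ fun a => x a)
    ⟨fun x _ => hΦ01 _, fun x _ y _ => hΦL _ _⟩
  obtain ⟨h, hh⟩ := hX B' hB' (fun b => β b) (isometry_subtype_coe.comp hβ) ε₁ hε₁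
  have key : ∀ i, |Φ (fun a => β (α' i a)) - δ * f ((e i).1 • h⁻¹ • y₀)| ≤ 3 * ε₁ := by
    intro i
    have h1 := hΦ (h * (e i).1⁻¹)
    rw [mul_inv_rev, inv_inv, mul_smul] at h1
    have h2 := (hΦL (fun a => β (α' i a)) fun a : A => (h * (e i).1⁻¹) a).trans
      (embDist_le (r := 2 * ε₁) (by positivity) fun a => by
        refine (dist_triangle _ (h (α' i a)) _).trans ?_
        have h3 := (hh (α' i a)).le
        have h4 := hαα' i a
        rw [dist_comm, ← h.isometry.dist_eq] at h4
        rw [IsometryEquiv.mul_apply]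
        linarith)
    exact (abs_sub_le _ _ _).trans (by linarith)
  refine ⟨h⁻¹, fun g hg g' hg' => ?_⟩
  obtain ⟨i, hi⟩ := e.surjective ⟨g, hg⟩
  obtain ⟨j, hj⟩ := e.surjective ⟨g', hg'⟩
  have h1 := abs_le.1 (key i)
  have h2 := abs_le.1 (key j)
  have h3 := abs_lt.1 (hβosc i j)
  rw [hi] at h1
  rw [hj] at h2
  simp only [Function.comp_apply] at h3
  refine abs_le.2 ⟨?_, ?_⟩ <;> refine le_of_mul_le_mul_left ?_ hδ <;> linarith [h1.1, h1.2, h2.1,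
    h2.2, h3.1, h3.2]

theorem exists_mem_closure_orbit (hR : WeakApproximateRamsey X)
    (hX : ApproxUltrahomogeneous X) {f : Y → ℝ} (hf : Continuous f)
    (hf01 : ∀ y, f y ∈ Icc (0 : ℝ) 1) (y₀ : Y) :
    ∃ y ∈ closure (MulAction.orbit (X ≃ᵢ X) y₀), ∀ g : X ≃ᵢ X, f (g • y) = f y := by
  classical
  let t : Finset (X ≃ᵢ X) × ℕ → Set Y := fun s =>
    closure (MulAction.orbit (X ≃ᵢ X) y₀) ∩
      {y | ∀ g ∈ s.1, ∀ g' ∈ s.1, |f (g • y) - f (g' • y)| ≤ 1 / ((s.2 : ℝ) + 1)}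
  have htcl : ∀ s, IsClosed (t s) := by
    intro s
    refine isClosed_closure.inter ?_
    simp only [ofPred_forall]
    exact isClosed_iInter fun g => isClosed_iInter fun _ => isClosed_iInter fun g' =>
      isClosed_iInter fun _ => isClosed_le (by fun_prop) continuous_const
  have hmono : ∀ s s', s ≤ s' → t s' ⊆ t s := fun s s' hs y hy =>
    ⟨hy.1, fun g hg g' hg' => (hy.2 g (hs.1 hg) g' (hs.1 hg')).trans
      (one_div_le_one_div_of_le (by positivity) (by gcongr; exact hs.2))⟩
  obtain ⟨y, hy⟩ := IsCompact.nonempty_iInter_of_directed_nonempty_isCompact_isClosed t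
    (fun s s' => ⟨s ⊔ s', hmono _ _ le_sup_left, hmono _ _ le_sup_right⟩)
    (fun s => by
      obtain ⟨h, hh⟩ := hR.exists_forall_abs_smul_sub_le hX hf hf01 y₀ s.1
        (show (0 : ℝ) < 1 / ((s.2 : ℝ) + 1) by positivity)
      exact ⟨h • y₀, subset_closure (MulAction.mem_orbit y₀ h), hh⟩)
    (fun s => (htcl s).isCompact) htcl
  rw [mem_iInter] at hy
  refine ⟨y, (hy (∅, 0)).1, fun g => eq_of_abs_sub_le_all fun ε hε => ?_⟩
  obtain ⟨n, hn⟩ := exists_nat_one_div_lt hε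
  have := (hy ({g, 1}, n)).2 g (by simp) 1 (by simp)
  rw [one_smul] at this
  exact this.trans hn.le

theorem exists_fixedPoint [T2Space Y] [Nonempty Y] (hR : WeakApproximateRamsey X)
    (hX : ApproxUltrahomogeneous X) : ∃ y : Y, ∀ g : X ≃ᵢ X, g • y = y := by
  classical
  let t : {f : C(Y, ℝ) // ∀ y, f y ∈ Icc (0 : ℝ) 1} → Set Y := fun f =>
    {y | ∀ g : X ≃ᵢ X, f.1 (g • y) = f.1 y}
  have htcl : ∀ f, IsClosed (t f) := by
    intro f
    simp only [t, ofPred_forall]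
    exact isClosed_iInter fun g => isClosed_eq (by fun_prop) (by fun_prop)
  have hinv : ∀ f, ∀ y ∈ t f, ∀ g : X ≃ᵢ X, g • y ∈ t f := fun f y hy g k => by
    rw [← mul_smul, hy, hy]
  have hne : ∀ s : Finset {f : C(Y, ℝ) // ∀ y, f y ∈ Icc (0 : ℝ) 1},
      (⋂ f ∈ s, t f).Nonempty := by
    intro s
    induction s using Finset.induction_on with
    | empty => simp
    | insert f s _ ih =>
      obtain ⟨y₀, hy₀⟩ := ih
      obtain ⟨y, hy, hfy⟩ := hR.exists_mem_closure_orbit hX f.1.continuous f.2 y₀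
      refine ⟨y, ?_⟩
      rw [Finset.set_biInter_insert]
      refine ⟨hfy, closure_minimal ?_ (isClosed_biInter fun f _ => htcl f) hy⟩
      rintro _ ⟨g, rfl⟩
      exact mem_iInter₂.2 fun f hf => hinv f y₀ (mem_iInter₂.1 hy₀ f hf) g
  obtain ⟨y, hy⟩ := CompactSpace.iInter_nonempty htcl hne
  refine ⟨y, fun g => by_contra fun hg => ?_⟩
  obtain ⟨f, hf0, hf1, hf⟩ := exists_continuous_zero_one_of_isClosed
    (isClosed_singleton (x := g • y)) (isClosed_singleton (x := y)) (by simpa using hg)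
  have h := mem_iInter.1 hy ⟨f, hf⟩ g
  have h0 := hf0 rfl
  have h1 := hf1 rfl
  simp_all

end WeakApproximateRamsey

/-- For an approximately ultrahomogeneous Polish metric space `X`, the isometry group of `X`,
with the topology of pointwise convergence, is extremely amenable iff `X` has the weak
approximate Ramsey property. -/
theorem extremelyAmenable_iff_weakApproximateRamsey
    (X : Type*) [MetricSpace X] [TopologicalSpace.SeparableSpace X] [CompleteSpace X]
    (hX : ApproxUltrahomogeneous X) :
    @ExtremelyAmenable (X ≃ᵢ X) _ (isoPointwiseTopology X) ↔
    (∀ A B : Set X, A.Finite → B.Finite → A ⊆ B →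
      ∀ m : ℕ, ∀ α : Fin m → (↥A → ↥B), (∀ i, Isometry (α i)) →
      ∀ ε : ℝ, 0 < ε →
      ∃ B' : Set X, B'.Finite ∧ A ⊆ B' ∧
        ∃ α' : Fin m → (↥A → ↥B'), (∀ i, Isometry (α' i)) ∧
          (∀ i, ∀ a : ↥A, dist (α i a : X) (α' i a : X) ≤ ε) ∧
          ∃ C : Set X, C.Finite ∧
            ∀ γ : (↥A → ↥C) → ℝ, IsColoringOn {δ : ↥A → ↥C | Isometry δ} γ →
              ∃ β : ↥B' → ↥C, Isometry β ∧
                ∀ i j : Fin m, |γ (β ∘ α' i) - γ (β ∘ α' j)| < ε) := by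
  let := isoPointwiseTopology X
  refine ⟨fun hG A B hA hB hAB m α hα ε hε => ?_, fun hR Y _ _ _ _ _ _ =>
    WeakApproximateRamsey.exists_fixedPoint hR hX⟩
  obtain ⟨C, hC, h⟩ := ExtremelyAmenable.exists_finite_ramsey hG hX hA hB α hα hε
  exact ⟨B, hB, hAB, α, hα, fun i a => (dist_self _).trans_le hε.le, C, hC, h⟩
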